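/- For every nonnegative integer m and every sufficiently smooth function u on (0,1] (with the norms below finite) one has ‖u‖_{Y^m} ≤ ‖u‖_{X^m} ≤ ‖u‖_{Y^{m+1}}; moreover there exists a constant C = C(m) > 0 such that ‖s u'‖_{X^m} ≤ C ‖u‖_{Y^{m+1}}, where (s u')(s) = s·u'(s). -/

import Mathlib

open MeasureTheory ENNReal RealInnerProductSpace

noncomputable section

/-- The weighted L² norm `‖s^α v‖_{L²(0,1)} = (∫₀¹ s^{2α} ‖v s‖² ds)^{1/2}`, valued in `[0,∞]`. -/
def wL2 {E : Type*} [NormedAddCommGroup E] (α : ℝ) (v : ℝ → E) : ℝ≥0∞ :=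
  (∫⁻ s in Set.Ioo (0:ℝ) 1, ENNReal.ofReal (s ^ (2 * α) * ‖v s‖ ^ 2)) ^ ((1:ℝ) / 2)

/-- The weighted L^∞ norm `‖s^α v‖_{L^∞(0,1)} = sup_{0<s<1} s^α ‖v s‖`, valued in `[0,∞]`. -/
def wLinf {E : Type*} [NormedAddCommGroup E] (α : ℝ) (v : ℝ → E) : ℝ≥0∞ :=
  ⨆ s : Set.Ioo (0:ℝ) 1, ENNReal.ofReal ((s : ℝ) ^ α * ‖v (s : ℝ)‖)

/-- The square of the weighted Sobolev norm `X^m` on `(0,1)`: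
for `m = 2k`, `‖u‖_{X^m}² = Σ_{i=0}^{k} ‖∂^i u‖² + Σ_{j=1}^{k} ‖s^j ∂^{k+j} u‖²`;
for `m = 2k+1`, `‖u‖_{X^m}² = Σ_{i=0}^{k} ‖∂^i u‖² + Σ_{j=1}^{k+1} ‖s^{j-1/2} ∂^{k+j} u‖²`. -/
def XnormSq {E : Type*} [NormedAddCommGroup E] [NormedSpace ℝ E] (m : ℕ) (u : ℝ → E) : ℝ≥0∞ :=
  if m % 2 = 0 then
    (∑ i ∈ Finset.range (m / 2 + 1), wL2 0 (iteratedDeriv i u) ^ 2) +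
      ∑ j ∈ Finset.range (m / 2), wL2 ((j : ℝ) + 1) (iteratedDeriv (m / 2 + j + 1) u) ^ 2
  else
    (∑ i ∈ Finset.range (m / 2 + 1), wL2 0 (iteratedDeriv i u) ^ 2) +
      ∑ j ∈ Finset.range (m / 2 + 1), wL2 ((j : ℝ) + 1 / 2) (iteratedDeriv (m / 2 + j + 1) u) ^ 2

/-- The weighted Sobolev norm `X^m`, valued in `[0,∞]`. -/
def Xnorm {E : Type*} [NormedAddCommGroup E] [NormedSpace ℝ E] (m : ℕ) (u : ℝ → E) : ℝ≥0∞ :=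
  XnormSq m u ^ ((1:ℝ) / 2)

/-- The square of the companion weighted Sobolev norm `Y^m` on `(0,1)`:
for `m = 2k`, `‖u‖_{Y^m}² = Σ_{i=0}^{k-1} ‖∂^i u‖² + Σ_{j=1}^{k+1} ‖s^{j-1/2} ∂^{k+j-1} u‖²`;
for `m = 2k+1`, `‖u‖_{Y^m}² = Σ_{i=0}^{k} ‖∂^i u‖² + Σ_{j=1}^{k+1} ‖s^{j} ∂^{k+j} u‖²`. -/
def YnormSq {E : Type*} [NormedAddCommGroup E] [NormedSpace ℝ E] (m : ℕ) (u : ℝ → E) : ℝ≥0∞ :=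
  if m % 2 = 0 then
    (∑ i ∈ Finset.range (m / 2), wL2 0 (iteratedDeriv i u) ^ 2) +
      ∑ j ∈ Finset.range (m / 2 + 1), wL2 ((j : ℝ) + 1 / 2) (iteratedDeriv (m / 2 + j) u) ^ 2
  else
    (∑ i ∈ Finset.range (m / 2 + 1), wL2 0 (iteratedDeriv i u) ^ 2) +
      ∑ j ∈ Finset.range (m / 2 + 1), wL2 ((j : ℝ) + 1) (iteratedDeriv (m / 2 + j + 1) u) ^ 2

/-- The weighted Sobolev norm `Y^m`, valued in `[0,∞]`. -/
def Ynorm {E : Type*} [NormedAddCommGroup E] [NormedSpace ℝ E] (m : ℕ) (u : ℝ → E) : ℝ≥0∞ :=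
  YnormSq m u ^ ((1:ℝ) / 2)

lemma wL2_sq (α : ℝ) (v : ℝ → ℝ) :
    wL2 α v ^ 2 = ∫⁻ s in Set.Ioo (0:ℝ) 1, ENNReal.ofReal (s ^ (2 * α) * ‖v s‖ ^ 2) := by
  unfold wL2
  rw [← ENNReal.rpow_natCast, ← ENNReal.rpow_mul]
  norm_num

lemma wL2_sq_anti {α β : ℝ} (h : α ≤ β) (v : ℝ → ℝ) : wL2 β v ^ 2 ≤ wL2 α v ^ 2 := by
  rw [wL2_sq, wL2_sq]
  refine setLIntegral_mono' measurableSet_Ioo fun s hs => ?_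
  apply ENNReal.ofReal_le_ofReal
  apply mul_le_mul_of_nonneg_right _ (by positivity)
  exact Real.rpow_le_rpow_of_exponent_ge hs.1 hs.2.le (by linarith)

lemma iter_formula (u : ℝ → ℝ) (hu : ContDiffOn ℝ (⊤ : ℕ∞) u (Set.Ioi 0)) (n : ℕ) :
    ∀ s : ℝ, 0 < s → iteratedDeriv n (fun s => s * deriv u s) s =
      s * iteratedDeriv (n + 1) u s + n * iteratedDeriv n u s := by
  have hd : ∀ n : ℕ, ∀ s : ℝ, 0 < s → DifferentiableAt ℝ (iteratedDeriv n u) s := by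
    intro n s hs
    have h1 : DifferentiableOn ℝ (iteratedDerivWithin n u (Set.Ioi 0)) (Set.Ioi 0) :=
      hu.differentiableOn_iteratedDerivWithin (by exact_mod_cast ENat.natCast_lt_top n)
        (uniqueDiffOn_Ioi 0)
    have h2 := h1.congr (fun x hx => (iteratedDerivWithin_of_isOpen (n := n) (f := u) isOpen_Ioi hx).symm)
    exact h2.differentiableAt (Ioi_mem_nhds hs)
  induction n with
  | zero => intro s hs; simp [iteratedDeriv_one]
  | succ n ih =>
    intro s hs
    rw [iteratedDeriv_succ]
    have he : iteratedDeriv n (fun s => s * deriv u s) =ᶠ[nhds s]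
        fun s => s * iteratedDeriv (n + 1) u s + n * iteratedDeriv n u s := by
      filter_upwards [Ioi_mem_nhds hs] with x hx using ih x hx
    rw [he.deriv_eq]
    have h1 := (hasDerivAt_id s).mul (hd (n + 1) s hs).hasDerivAt
    have h2 := ((hd n s hs).hasDerivAt).const_mul (n : ℝ)
    have h3 := (h1.add h2).deriv
    rw [← iteratedDeriv_succ, ← iteratedDeriv_succ] at h3
    refine Eq.trans h3 ?_
    simp only [id]
    push_cast
    ring

lemma term_bound (u : ℝ → ℝ) (hu : ContDiffOn ℝ (⊤ : ℕ∞) u (Set.Ioi 0)) (n : ℕ) (α : ℝ) :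
    wL2 α (iteratedDeriv n (fun s => s * deriv u s)) ^ 2 ≤
      ENNReal.ofReal 2 * wL2 (α + 1) (iteratedDeriv (n + 1) u) ^ 2 +
      ENNReal.ofReal (2 * (n : ℝ) ^ 2) * wL2 α (iteratedDeriv n u) ^ 2 := by
  rw [wL2_sq, wL2_sq, wL2_sq, ← lintegral_const_mul' _ _ ENNReal.ofReal_ne_top,
    ← lintegral_const_mul' _ _ ENNReal.ofReal_ne_top]
  have hm : Measurable (iteratedDeriv (n + 1) u) := by
    rw [iteratedDeriv_succ]; exact measurable_deriv _
  rw [← lintegral_add_left (by fun_prop)]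
  refine setLIntegral_mono' measurableSet_Ioo fun s hs => ?_
  have h0 : 0 < s := hs.1
  have hp : 0 ≤ s ^ (2 * α) := by positivity
  rw [← ENNReal.ofReal_mul (by positivity), ← ENNReal.ofReal_mul (by positivity),
    ← ENNReal.ofReal_add (by positivity) (by positivity)]
  apply ENNReal.ofReal_le_ofReal
  rw [iter_formula u hu n s h0]
  have e : s ^ (2 * (α + 1)) = s ^ (2 * α) * s ^ 2 := by
    rw [mul_add, Real.rpow_add h0]; norm_num
  rw [e]
  simp only [Real.norm_eq_abs, sq_abs]
  have := mul_nonneg hp (sq_nonneg (s * iteratedDeriv (n + 1) u s - n * iteratedDeriv n u s))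
  nlinarith

lemma term_bound' (u : ℝ → ℝ) (hu : ContDiffOn ℝ (⊤ : ℕ∞) u (Set.Ioi 0)) (n M : ℕ) (hn : n ≤ M)
    (α : ℝ) (S : ℝ≥0∞) (h1 : wL2 (α + 1) (iteratedDeriv (n + 1) u) ^ 2 ≤ S)
    (h2 : wL2 α (iteratedDeriv n u) ^ 2 ≤ S) :
    wL2 α (iteratedDeriv n (fun s => s * deriv u s)) ^ 2 ≤
      ENNReal.ofReal (2 + 2 * (M : ℝ) ^ 2) * S := by
  refine (term_bound u hu n α).trans ?_
  rw [ENNReal.ofReal_add (by positivity) (by positivity), add_mul]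
  gcongr

lemma X_even (k : ℕ) (u : ℝ → ℝ) : XnormSq (2 * k) u =
    (∑ i ∈ Finset.range (k + 1), wL2 0 (iteratedDeriv i u) ^ 2) +
      ∑ j ∈ Finset.range k, wL2 ((j : ℝ) + 1) (iteratedDeriv (k + j + 1) u) ^ 2 := by
  have h1 : (2 * k) % 2 = 0 := by omega
  have h2 : (2 * k) / 2 = k := by omega
  simp only [XnormSq, h1, h2, if_true]

lemma X_odd (k : ℕ) (u : ℝ → ℝ) : XnormSq (2 * k + 1) u =
    (∑ i ∈ Finset.range (k + 1), wL2 0 (iteratedDeriv i u) ^ 2) +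
      ∑ j ∈ Finset.range (k + 1), wL2 ((j : ℝ) + 1 / 2) (iteratedDeriv (k + j + 1) u) ^ 2 := by
  have h1 : ¬ (2 * k + 1) % 2 = 0 := by omega
  have h2 : (2 * k + 1) / 2 = k := by omega
  simp only [XnormSq, if_neg h1, h2]

lemma Y_even (k : ℕ) (u : ℝ → ℝ) : YnormSq (2 * k) u =
    (∑ i ∈ Finset.range k, wL2 0 (iteratedDeriv i u) ^ 2) +
      ∑ j ∈ Finset.range (k + 1), wL2 ((j : ℝ) + 1 / 2) (iteratedDeriv (k + j) u) ^ 2 := by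
  have h1 : (2 * k) % 2 = 0 := by omega
  have h2 : (2 * k) / 2 = k := by omega
  simp only [YnormSq, h1, h2, if_true]

lemma Y_odd (k : ℕ) (u : ℝ → ℝ) : YnormSq (2 * k + 1) u =
    (∑ i ∈ Finset.range (k + 1), wL2 0 (iteratedDeriv i u) ^ 2) +
      ∑ j ∈ Finset.range (k + 1), wL2 ((j : ℝ) + 1) (iteratedDeriv (k + j + 1) u) ^ 2 := by
  have h1 : ¬ (2 * k + 1) % 2 = 0 := by omega
  have h2 : (2 * k + 1) / 2 = k := by omega
  simp only [YnormSq, if_neg h1, h2]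

lemma Y_le_X (m : ℕ) (u : ℝ → ℝ) : YnormSq m u ≤ XnormSq m u := by
  obtain ⟨k, rfl | rfl⟩ := Nat.even_or_odd' m
  · rw [Y_even, X_even, Finset.sum_range_succ', Finset.sum_range_succ (n := k), add_assoc,
      add_comm (∑ j ∈ Finset.range k, _ : ℝ≥0∞) (wL2 (((0:ℕ):ℝ) + 1 / 2) _ ^ 2)]
    refine add_le_add le_rfl ?_
    refine add_le_add ?_ (Finset.sum_le_sum fun j hj => ?_)
    · exact wL2_sq_anti (by norm_num) _
    · rw [← add_assoc]
      exact wL2_sq_anti (by push_cast; linarith) _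
  · rw [Y_odd, X_odd]
    refine add_le_add le_rfl (Finset.sum_le_sum fun j hj => ?_)
    exact wL2_sq_anti (by linarith) _

lemma X_le_Y (m : ℕ) (u : ℝ → ℝ) : XnormSq m u ≤ YnormSq (m + 1) u := by
  obtain ⟨k, rfl | rfl⟩ := Nat.even_or_odd' m
  · rw [Y_odd, X_even]
    gcongr
    simp
  · rw [show 2 * k + 1 + 1 = 2 * (k + 1) by ring, Y_even, X_odd]
    refine add_le_add le_rfl ?_
    rw [Finset.sum_range_succ (n := k + 1)]
    refine le_trans (le_of_eq ?_) le_self_add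
    refine Finset.sum_congr rfl fun j _ => ?_
    rw [show k + j + 1 = k + 1 + j by ring]

lemma sum_bound {n N : ℕ} (h : n ≤ N) (f : ℕ → ℝ≥0∞) (B : ℝ≥0∞)
    (hf : ∀ i < n, f i ≤ B) : ∑ i ∈ Finset.range n, f i ≤ ENNReal.ofReal N * B := by
  refine (Finset.sum_le_card_nsmul _ f B (fun i hi => hf i (Finset.mem_range.1 hi))).trans ?_
  simp only [Finset.card_range, nsmul_eq_mul, ENNReal.ofReal_natCast]
  gcongr

lemma two_sum_bound (a b N : ℕ) (ha : a ≤ N) (hb : b ≤ N) (f g : ℕ → ℝ≥0∞) (c : ℝ)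
    (S : ℝ≥0∞) (hf : ∀ i < a, f i ≤ ENNReal.ofReal c * S)
    (hg : ∀ i < b, g i ≤ ENNReal.ofReal c * S) :
    ∑ i ∈ Finset.range a, f i + ∑ i ∈ Finset.range b, g i ≤
      ENNReal.ofReal ((2 * N) * c) * S := by
  refine (add_le_add (sum_bound ha f _ hf) (sum_bound hb g _ hg)).trans (le_of_eq ?_)
  rw [ENNReal.ofReal_mul (by positivity), ENNReal.ofReal_mul (by norm_num)]
  simp only [ENNReal.ofReal_ofNat]
  ring

lemma third (m : ℕ) (u : ℝ → ℝ) (hu : ContDiffOn ℝ (⊤ : ℕ∞) u (Set.Ioi 0)) :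
    XnormSq m (fun s => s * deriv u s) ≤
      ENNReal.ofReal ((2 * ((m + 1 : ℕ) : ℝ)) * (2 + 2 * ((m + 1 : ℕ) : ℝ) ^ 2)) *
        YnormSq (m + 1) u := by
  obtain ⟨k, rfl | rfl⟩ := Nat.even_or_odd' m
  · have hA : ∀ i < k + 1, wL2 0 (iteratedDeriv i u) ^ 2 ≤ YnormSq (2 * k + 1) u := by
      intro i hi
      rw [Y_odd]
      exact (Finset.single_le_sum (f := fun i => wL2 0 (iteratedDeriv i u) ^ 2)
        (fun _ _ => zero_le) (Finset.mem_range.2 hi)).trans le_self_add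
    have hB : ∀ j < k + 1, wL2 ((j : ℝ) + 1) (iteratedDeriv (k + j + 1) u) ^ 2 ≤
        YnormSq (2 * k + 1) u := by
      intro i hi
      rw [Y_odd]
      exact (Finset.single_le_sum
        (f := fun j : ℕ => wL2 ((j : ℝ) + 1) (iteratedDeriv (k + j + 1) u) ^ 2)
        (fun _ _ => zero_le) (Finset.mem_range.2 hi)).trans le_add_self
    rw [X_even]
    apply two_sum_bound _ _ _ (by omega) (by omega)
    · intro i hi
      refine term_bound' u hu _ _ (by omega) _ _ ?_ (hA i hi)
      rcases Nat.lt_succ_iff_lt_or_eq.1 hi with h | rfl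
      · exact (wL2_sq_anti (by norm_num) _).trans (hA (i + 1) (by omega))
      · simpa using hB 0 (by omega)
    · intro j hj
      refine term_bound' u hu _ _ (by omega) _ _ ?_ (hB j (by omega))
      have := hB (j + 1) (by omega)
      push_cast at this
      exact this
  · have hA : ∀ i < k + 1, wL2 0 (iteratedDeriv i u) ^ 2 ≤ YnormSq (2 * (k + 1)) u := by
      intro i hi
      rw [Y_even]
      exact (Finset.single_le_sum (f := fun i => wL2 0 (iteratedDeriv i u) ^ 2)
        (fun _ _ => zero_le) (Finset.mem_range.2 hi)).trans le_self_add
    have hB : ∀ j < k + 2, wL2 ((j : ℝ) + 1 / 2) (iteratedDeriv (k + j + 1) u) ^ 2 ≤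
        YnormSq (2 * (k + 1)) u := by
      intro i hi
      rw [Y_even, show k + i + 1 = k + 1 + i by ring]
      exact (Finset.single_le_sum
        (f := fun j : ℕ => wL2 ((j : ℝ) + 1 / 2) (iteratedDeriv (k + 1 + j) u) ^ 2)
        (fun _ _ => zero_le) (Finset.mem_range.2 hi)).trans le_add_self
    rw [X_odd, show YnormSq (2 * k + 1 + 1) u = YnormSq (2 * (k + 1)) u from rfl]
    apply two_sum_bound _ _ _ (by omega) (by omega)
    · intro i hi
      refine term_bound' u hu _ _ (by omega) _ _ ?_ (hA i hi)
      rcases Nat.lt_succ_iff_lt_or_eq.1 hi with h | rfl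
      · exact (wL2_sq_anti (by norm_num) _).trans (hA (i + 1) (by omega))
      · exact (wL2_sq_anti (by norm_num) _).trans (hB 0 (by omega))
    · intro j hj
      refine term_bound' u hu _ _ (by omega) _ _ ?_ (hB j (by omega))
      have := hB (j + 1) (by omega)
      push_cast at this
      rw [show (j : ℝ) + 1 / 2 + 1 = (j : ℝ) + 1 + 1 / 2 by ring]
      exact this

/-- `‖u‖_{Y^m} ≤ ‖u‖_{X^m} ≤ ‖u‖_{Y^{m+1}}` and `‖s u'‖_{X^m} ≤ C ‖u‖_{Y^{m+1}}`. -/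
theorem stmt4 (m : ℕ) :
    ∃ C : ℝ, 0 < C ∧ ∀ u : ℝ → ℝ,
      ContDiffOn ℝ (⊤ : ℕ∞) u (Set.Ioi 0) →
      Ynorm m u ≠ ⊤ → Xnorm m u ≠ ⊤ → Ynorm (m + 1) u ≠ ⊤ →
      Ynorm m u ≤ Xnorm m u ∧ Xnorm m u ≤ Ynorm (m + 1) u ∧
        Xnorm m (fun s => s * deriv u s) ≤ ENNReal.ofReal C * Ynorm (m + 1) u := by
  set K : ℝ := (2 * ((m + 1 : ℕ) : ℝ)) * (2 + 2 * ((m + 1 : ℕ) : ℝ) ^ 2) with hK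
  have hKpos : 0 < K := by positivity
  refine ⟨K ^ ((1:ℝ) / 2), by positivity, fun u hu _ _ _ => ⟨?_, ?_, ?_⟩⟩
  · exact ENNReal.rpow_le_rpow (Y_le_X m u) (by norm_num)
  · exact ENNReal.rpow_le_rpow (X_le_Y m u) (by norm_num)
  · have h := ENNReal.rpow_le_rpow (z := (1:ℝ) / 2) (third m u hu) (by norm_num)
    rw [ENNReal.mul_rpow_of_nonneg _ _ (by norm_num), ← hK,
      ENNReal.ofReal_rpow_of_pos hKpos] at h
    exact h
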